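/- A commutative ring R is a C.P. ring if and only if every prime ideal of R is the radical of a principal ideal. -/

import Mathlib

/-- A commutative ring is C.P. (compactly packed) if whenever an ideal is
contained in the union of an arbitrary family of prime ideals, it is contained
in one of them. -/
def IsCP (R : Type*) [CommRing R] : Prop :=
  ∀ S : Set (Ideal R), (∀ p ∈ S, p.IsPrime) →
    ∀ I : Ideal R, (I : Set R) ⊆ (⋃ p ∈ S, (p : Set R)) → ∃ p ∈ S, I ≤ p

theorem isCP_iff_prime_radical_principal (R : Type*) [CommRing R] :
    IsCP R ↔ ∀ p : Ideal R, p.IsPrime → ∃ f : R, (Ideal.span {f}).radical = p := by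
  constructor
  · intro h p hp
    have hS : ¬ (p : Set R) ⊆ ⋃ q ∈ {q : Ideal R | q.IsPrime ∧ ¬ p ≤ q}, (q : Set R) := by
      intro hsub
      obtain ⟨q, hq, hpq⟩ := h _ (fun q hq => hq.1) p hsub
      exact hq.2 hpq
    obtain ⟨f, hfp, hf⟩ := Set.not_subset.mp hS
    refine ⟨f, le_antisymm ?_ ?_⟩
    · exact hp.radical_le_iff.mpr ((Ideal.span_singleton_le_iff_mem p).mpr hfp)
    · rw [Ideal.radical_eq_sInf]
      refine le_sInf fun q hq => ?_
      by_contra hpq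
      exact hf (Set.mem_biUnion (x := q) ⟨hq.2, hpq⟩
        ((Ideal.span_singleton_le_iff_mem q).mp hq.1))
  · intro h S hS I hI
    let T : Submonoid R := ⨅ q : S, @Ideal.primeCompl R _ q.1 (hS q.1 q.2)
    have hIT : Disjoint (I : Set R) T := by
      refine Set.disjoint_left.mpr fun x hxI hxT => ?_
      obtain ⟨q, hq, hxq⟩ := Set.mem_iUnion₂.mp (hI hxI)
      exact Submonoid.mem_iInf.mp hxT ⟨q, hq⟩ hxq
    obtain ⟨P, hP, hIP, hPT⟩ := Ideal.exists_le_prime_disjoint I T hIT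
    obtain ⟨f, hf⟩ := h P hP
    have hfP : f ∈ P := hf ▸ Ideal.le_radical (Ideal.mem_span_singleton_self f)
    have hfT : f ∉ T := Set.disjoint_left.mp hPT hfP
    obtain ⟨q, hfq⟩ := not_forall.mp fun hall => hfT (Submonoid.mem_iInf.mpr hall)
    refine ⟨q.1, q.2, hIP.trans ?_⟩
    rw [← hf, (hS q.1 q.2).radical_le_iff, Ideal.span_singleton_le_iff_mem]
    exact not_not.mp hfq
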